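/- For every mean payoff game, if Eve has a strategy ensuring mean payoff, then she has a positional strategy ensuring mean payoff (i.e., some positional strategy induces a strategy ensuring mean payoff). -/

import Mathlib

open Filter


/-- A finite path: a list of consecutive edges, all belonging to `E`,
starting at `u` (when nonempty). -/
def FinPath {V : Type} (E : Set (V × ℤ × V)) (u : V) (p : List (V × ℤ × V)) : Prop :=
  (∀ e ∈ p, e ∈ E) ∧ List.Chain' (fun e e' => e.2.2 = e'.1) p ∧
    ∀ h : p ≠ [], (p.head h).1 = u

/-- The last vertex of a finite path starting at `u` (which is `u` itself for the empty path). -/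
def lastV {V : Type} (u : V) (p : List (V × ℤ × V)) : V :=
  (p.getLastD (u, 0, u)).2.2

/-- An infinite path: a sequence of consecutive edges, all belonging to `E`. -/
def InfPath {V : Type} (E : Set (V × ℤ × V)) (π : ℕ → V × ℤ × V) : Prop :=
  (∀ i, π i ∈ E) ∧ ∀ i, (π i).2.2 = (π (i + 1)).1

/-- The total weight of a finite path. -/
def pathWeight {V : Type} (p : List (V × ℤ × V)) : ℤ :=
  (p.map fun e => e.2.1).sum

/-- A sequence of integer weights satisfies mean payoff if the liminf of the
averages of its prefixes is nonnegative. -/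
def MeanPayoffSeq (w : ℕ → ℤ) : Prop :=
  0 ≤ Filter.atTop.liminf (fun ℓ : ℕ => (∑ i ∈ Finset.range ℓ, (w i : ℝ)) / (ℓ : ℝ))

/-- A graph (given by its edge set) satisfies mean payoff if all its infinite paths do. -/
def SatMP {V : Type} (E : Set (V × ℤ × V)) : Prop :=
  ∀ π : ℕ → V × ℤ × V, InfPath E π → MeanPayoffSeq (fun i => (π i).2.1)

/-- A cycle: a nonempty finite path whose first and last vertices coincide. -/
def IsCycle {V : Type} (E : Set (V × ℤ × V)) (p : List (V × ℤ × V)) : Prop :=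
  p ≠ [] ∧ ∃ v, FinPath E v p ∧ lastV v p = v

/-- A `W`-graph: a finite set of vertices, edges labelled by weights in `W`,
and an initial vertex from which every vertex is reachable. -/
structure WGraph (W : Finset ℤ) where
  V : Type
  fin : Fintype V
  E : Set (V × ℤ × V)
  init : V
  wt : ∀ e ∈ E, e.2.1 ∈ W
  reach : ∀ v : V, ∃ p, FinPath E init p ∧ lastV init p = v

attribute [instance] WGraph.fin

/-- A mean payoff game: a `W`-graph together with a set of vertices controlled by Eve
(the remaining vertices being controlled by Adam), where every vertex has an
outgoing edge. -/
structure MPGame (W : Finset ℤ) extends WGraph W where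
  EveV : Set V
  succ_exists : ∀ v : V, ∃ e ∈ E, e.1 = v

/-- A strategy for Eve: maps finite paths from the initial vertex (ending in a
vertex controlled by Eve) to an edge whose source is the last vertex of the path. -/
structure Strategy {W : Finset ℤ} (G : MPGame W) where
  f : List (G.V × ℤ × G.V) → G.V × ℤ × G.V
  valid : ∀ p, FinPath G.E G.init p → lastV G.init p ∈ G.EveV →
    f p ∈ G.E ∧ (f p).1 = lastV G.init p

/-- A positional strategy for Eve. -/
structure PosStrategy {W : Finset ℤ} (G : MPGame W) where
  f : G.V → G.V × ℤ × G.V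
  valid : ∀ v ∈ G.EveV, f v ∈ G.E ∧ (f v).1 = v

/-- The strategy induced by a positional strategy: it only looks at the last vertex. -/
def PosStrategy.induced {W : Finset ℤ} {G : MPGame W} (σ : PosStrategy G) :
    Strategy G where
  f := fun p => σ.f (lastV G.init p)
  valid := fun p _ hv => σ.valid _ hv

/-- An infinite path from the initial vertex consistent with a strategy. -/
def ConsistentPath {W : Finset ℤ} {G : MPGame W} (σ : Strategy G)
    (π : ℕ → G.V × ℤ × G.V) : Prop :=
  InfPath G.E π ∧ (π 0).1 = G.init ∧
    ∀ i, (π i).1 ∈ G.EveV → σ.f ((List.range i).map π) = π i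

/-- A strategy ensures mean payoff if every consistent infinite path from the
initial vertex satisfies mean payoff. -/
def EnsuresMP {W : Finset ℤ} {G : MPGame W} (σ : Strategy G) : Prop :=
  ∀ π, ConsistentPath σ π → MeanPayoffSeq (fun i => (π i).2.1)

/-- If the partial sums of a bounded weight sequence are bounded below,
then the sequence satisfies mean payoff. -/
theorem meanPayoffSeq_of_le_sum {w : ℕ → ℤ} {B C : ℕ} (hB : ∀ i, |w i| ≤ B)
    (hC : ∀ n, -(C : ℤ) ≤ ∑ i ∈ Finset.range n, w i) : MeanPayoffSeq w := by
  have habs : ∀ n : ℕ, (∑ i ∈ Finset.range n, (w i : ℝ)) ≤ n * B := by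
    intro n
    refine (Finset.sum_le_card_nsmul _ _ (B : ℝ) ?_).trans (by simp)
    intro i _
    exact_mod_cast (le_abs_self _).trans (hB i)
  have hlim : Tendsto (fun n : ℕ => -(C : ℝ) / n) atTop (nhds 0) :=
    tendsto_const_div_atTop_nhds_zero_nat _
  unfold MeanPayoffSeq
  rw [← hlim.liminf_eq]
  refine Filter.liminf_le_liminf (Eventually.of_forall fun n => ?_)
    hlim.isBoundedUnder_ge (IsBoundedUnder.isCoboundedUnder_ge ⟨B, ?_⟩)
  · have h : -(C : ℝ) ≤ ∑ i ∈ Finset.range n, (w i : ℝ) := by exact_mod_cast hC n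
    exact div_le_div_of_nonneg_right h n.cast_nonneg
  · refine Filter.eventually_map.2 (Eventually.of_forall fun n => ?_)
    exact div_le_of_le_mul₀ n.cast_nonneg B.cast_nonneg (by linarith [habs n])

/-- If the partial sums of a bounded weight sequence decrease at a linear rate,
then the sequence does not satisfy mean payoff. -/
theorem not_meanPayoffSeq_of_sum_le {w : ℕ → ℤ} {B N D : ℕ} (hB : ∀ i, |w i| ≤ B)
    (hD : ∀ n : ℕ, (N : ℤ) * ∑ i ∈ Finset.range n, w i + n ≤ D) : ¬ MeanPayoffSeq w := by
  have hN : (0 : ℝ) < N := by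
    rcases N.eq_zero_or_pos with rfl | h
    · have := hD (D + 1)
      push_cast at this
      omega
    · exact_mod_cast h
  have habs : ∀ n : ℕ, -(n * B : ℝ) ≤ ∑ i ∈ Finset.range n, (w i : ℝ) := by
    intro n
    refine le_trans (by simp) (Finset.card_nsmul_le_sum _ _ (-(B : ℝ)) ?_)
    intro i _
    exact_mod_cast (abs_le.1 (hB i)).1
  have hlim : Tendsto (fun n : ℕ => ((D : ℝ) / n - 1) / N) atTop (nhds ((0 - 1) / N)) :=
    ((tendsto_const_div_atTop_nhds_zero_nat _).sub_const 1).div_const _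
  unfold MeanPayoffSeq
  rw [not_le]
  refine lt_of_le_of_lt ?_ (div_neg_of_neg_of_pos (by norm_num) hN : ((0 : ℝ) - 1) / N < 0)
  rw [← hlim.liminf_eq]
  refine Filter.liminf_le_liminf ?_ ⟨-(B : ℝ), ?_⟩ hlim.isCoboundedUnder_ge
  · filter_upwards [eventually_gt_atTop 0] with n hn
    have hn : (0 : ℝ) < n := by exact_mod_cast hn
    have h : (N : ℝ) * ∑ i ∈ Finset.range n, (w i : ℝ) + n ≤ D := by exact_mod_cast hD n
    rw [div_sub_one hn.ne', div_div, div_le_div_iff₀ hn (by positivity)]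
    nlinarith
  · refine Filter.eventually_map.2 ?_
    filter_upwards [eventually_gt_atTop 0] with n hn
    have hn : (0 : ℝ) < n := by exact_mod_cast hn
    rw [ge_iff_le, le_div_iff₀ hn]
    linarith [habs n]

/-- A property of lists that can always be extended by one element is satisfied by all
prefixes of some infinite sequence. -/
theorem exists_seq_of_forall_extend {α : Type*} {P : List α → Prop} {R : List α → α → Prop}
    (h0 : P []) (h : ∀ p, P p → ∃ e, R p e ∧ P (p ++ [e])) :
    ∃ π : ℕ → α, ∀ n, P ((List.range n).map π) ∧ R ((List.range n).map π) (π n) := by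
  choose e he using h
  let s : ℕ → {p // P p} := fun n =>
    n.rec ⟨[], h0⟩ fun _ p => ⟨p.1 ++ [e p.1 p.2], (he p.1 p.2).2⟩
  let π : ℕ → α := fun n => e (s n).1 (s n).2
  have hs : ∀ n, (List.range n).map π = (s n).1 := by
    intro n
    induction n with
    | zero => rfl
    | succ n ih => rw [List.range_succ, List.map_append, ih]; rfl
  refine ⟨π, fun n => ?_⟩
  rw [hs]
  exact ⟨(s n).2, (he _ _).1⟩

theorem lastV_append_singleton {V : Type} (u : V) (p : List (V × ℤ × V)) (e : V × ℤ × V) :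
    lastV u (p ++ [e]) = e.2.2 := by
  simp [lastV]

theorem FinPath.append_singleton {V : Type} {E : Set (V × ℤ × V)} {u : V}
    {p : List (V × ℤ × V)} {e : V × ℤ × V} (hp : FinPath E u p) (he : e ∈ E)
    (h : e.1 = lastV u p) : FinPath E u (p ++ [e]) := by
  obtain ⟨h1, h2, h3⟩ := hp
  refine ⟨?_, ?_, ?_⟩
  · intro a ha
    rcases List.mem_append.1 ha with ha | ha
    · exact h1 a ha
    · rwa [List.mem_singleton.1 ha]
  · refine List.isChain_append.2 ⟨h2, List.isChain_singleton _, ?_⟩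
    intro x hx y hy
    obtain rfl : e = y := by simpa using hy
    rw [h, lastV, List.getLastD_eq_getLast?, Option.mem_def.1 hx, Option.getD_some]
  · intro _
    cases p with
    | nil => simpa [lastV] using h
    | cons a p => simpa using h3 (by simp)

theorem lastV_map_range {V : Type} {u : V} {π : ℕ → V × ℤ × V} (h0 : (π 0).1 = u)
    (h : ∀ i, (π i).2.2 = (π (i + 1)).1) (n : ℕ) :
    lastV u ((List.range n).map π) = (π n).1 := by
  cases n with
  | zero => simp [lastV, h0]
  | succ n => rw [List.range_succ, List.map_append, List.map_singleton,
      lastV_append_singleton, h]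

theorem pathWeight_map_range {V : Type} (π : ℕ → V × ℤ × V) (n : ℕ) :
    pathWeight ((List.range n).map π) = ∑ i ∈ Finset.range n, (π i).2.1 := by
  induction n with
  | zero => simp [pathWeight]
  | succ n ih =>
    rw [Finset.sum_range_succ, ← ih]
    simp [pathWeight, List.range_succ]

namespace MPGame

variable {W : Finset ℤ} (G : MPGame W)

theorem finite_edges : G.E.Finite := by
  refine ((Set.finite_univ (α := G.V)).prod
    (W.finite_toSet.prod (Set.finite_univ (α := G.V)))).subset ?_
  intro e he
  exact ⟨trivial, G.wt e he, trivial⟩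

theorem exists_weight_bound : ∃ B : ℕ, ∀ e ∈ G.E, |e.2.1| ≤ B := by
  refine ⟨∑ w ∈ W, w.natAbs, fun e he => ?_⟩
  have := Finset.single_le_sum (f := Int.natAbs) (fun _ _ => Nat.zero_le _) (G.wt e he)
  rw [Int.abs_eq_natAbs]
  exact_mod_cast this

/-- Eve can, in one move from `v`, guarantee that the edge taken satisfies `Q`. -/
def Forces (v : G.V) (Q : G.V × ℤ × G.V → Prop) : Prop :=
  (v ∈ G.EveV → ∃ e ∈ G.E, e.1 = v ∧ Q e) ∧ (v ∉ G.EveV → ∀ e ∈ G.E, e.1 = v → Q e)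

variable {G} in
theorem Forces.mono {v : G.V} {Q Q' : G.V × ℤ × G.V → Prop} (h : G.Forces v Q)
    (hQ : ∀ e ∈ G.E, e.1 = v → Q e → Q' e) : G.Forces v Q' :=
  ⟨fun hv => let ⟨e, he, h1, h2⟩ := h.1 hv; ⟨e, he, h1, hQ e he h1 h2⟩,
    fun hv e he h1 => hQ e he h1 (h.2 hv e he h1)⟩

/-- `φ` is a potential on `S`: Eve can stay in `S` while `φ` grows at most by the weights. -/
def IsPotential (S : Set G.V) (φ : G.V → ℕ) : Prop :=
  ∀ v ∈ S, G.Forces v fun e => e.2.2 ∈ S ∧ (φ e.2.2 : ℤ) ≤ φ v + e.2.1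

/-- A potential on `S` yields a positional strategy ensuring mean payoff. -/
theorem exists_posStrategy_of_isPotential {S : Set G.V} {φ : G.V → ℕ}
    (hφ : G.IsPotential S φ) (hS : G.init ∈ S) : ∃ σ : PosStrategy G, EnsuresMP σ.induced := by
  have hex : ∀ v : G.V, ∃ e ∈ G.E, e.1 = v ∧
      (v ∈ S → v ∈ G.EveV → e.2.2 ∈ S ∧ (φ e.2.2 : ℤ) ≤ φ v + e.2.1) := by
    intro v
    by_cases h : v ∈ S ∧ v ∈ G.EveV
    · obtain ⟨e, he, h1, h2⟩ := (hφ v h.1).1 h.2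
      exact ⟨e, he, h1, fun _ _ => h2⟩
    · obtain ⟨e, he, h1⟩ := G.succ_exists v
      exact ⟨e, he, h1, fun h1 h2 => absurd ⟨h1, h2⟩ h⟩
  choose f hfE hfv hf using hex
  refine ⟨⟨f, fun v _ => ⟨hfE v, hfv v⟩⟩, ?_⟩
  rintro π ⟨⟨hE, hπ⟩, h0, hcons⟩
  obtain ⟨B, hB⟩ := G.exists_weight_bound
  have hstep : ∀ i, (π i).1 ∈ S →
      (π i).2.2 ∈ S ∧ (φ (π i).2.2 : ℤ) ≤ φ (π i).1 + (π i).2.1 := by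
    intro i hi
    by_cases hv : (π i).1 ∈ G.EveV
    · have h1 : f (π i).1 = π i := by
        have : f (lastV G.init ((List.range i).map π)) = π i := hcons i hv
        rwa [lastV_map_range h0 hπ] at this
      have h2 := hf _ hi hv
      rwa [h1] at h2
    · exact (hφ _ hi).2 hv _ (hE i) rfl
  have hinv : ∀ n, (π n).1 ∈ S ∧
      (φ (π n).1 : ℤ) ≤ φ G.init + ∑ i ∈ Finset.range n, (π i).2.1 := by
    intro n
    induction n with
    | zero => simp [h0, hS]
    | succ n ih =>
      have := hstep n ih.1
      rw [← hπ n, Finset.sum_range_succ]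
      exact ⟨this.1, by linarith [ih.2, this.2]⟩
  refine meanPayoffSeq_of_le_sum (B := B) (C := φ G.init) (fun i => hB _ (hE i)) fun n => ?_
  have := (hinv n).2
  omega

/-- From `v` with credit `c`, Eve can keep the credit nonnegative for `n` steps, or reach `S`
before it gets negative (at the moment of reaching `S`, the credit is irrelevant). -/
def Survives (S : Set G.V) : ℕ → G.V → ℤ → Prop
  | 0, v, c => v ∈ S ∨ 0 ≤ c
  | n + 1, v, c => v ∈ S ∨ 0 ≤ c ∧ G.Forces v fun e => Survives S n e.2.2 (c + e.2.1)

variable {G} {S : Set G.V}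

theorem Survives.of_succ {n : ℕ} {v : G.V} {c : ℤ} (h : G.Survives S (n + 1) v c) :
    G.Survives S n v c := by
  induction n generalizing v c with
  | zero => exact h.imp id And.left
  | succ n ih => exact h.imp id fun h => ⟨h.1, h.2.mono fun e _ _ he => ih he⟩

theorem Survives.anti {m n : ℕ} (hmn : m ≤ n) {v : G.V} {c : ℤ} (h : G.Survives S n v c) :
    G.Survives S m v c := by
  induction n, hmn using Nat.le_induction with
  | base => exact h
  | succ n _ ih => exact ih h.of_succ

theorem Survives.nonneg {n : ℕ} {v : G.V} {c : ℤ} (h : G.Survives S n v c) (hv : v ∉ S) :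
    0 ≤ c :=
  (h.anti n.zero_le).resolve_left hv

/-- Compactness: if Eve survives arbitrarily long, then one move is good for all horizons. -/
theorem forces_of_forall_survives {v : G.V} {c : ℤ} (hv : v ∉ S)
    (h : ∀ n, G.Survives S n v c) :
    G.Forces v fun e => ∀ n, G.Survives S n e.2.2 (c + e.2.1) := by
  have h' := fun n => ((h (n + 1)).resolve_left hv).2
  refine ⟨fun hE => ?_, fun hA e he hev n => (h' n).2 hA e he hev⟩
  by_contra! hcon
  choose! m hm using hcon
  obtain ⟨N, hN⟩ := (G.finite_edges.image m).bddAbove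
  obtain ⟨e, he, hev, hs⟩ := (h' N).1 hE
  exact hm e he hev (hs.anti (hN ⟨e, he, rfl⟩))

/-- Outside of a maximal set with a potential, Eve runs out of any credit in bounded time. -/
theorem exists_not_survives
    (hS : Maximal (fun S => ∃ φ, G.IsPotential S φ) S) {v : G.V} (hv : v ∉ S) :
    ∃ n, ¬ G.Survives S n v 0 := by
  classical
  by_contra! hcon
  obtain ⟨φ, hφ⟩ := hS.prop
  obtain ⟨B, hB⟩ := G.exists_weight_bound
  let T : Set G.V := {u | u ∉ S ∧ ∃ c : ℕ, ∀ n, G.Survives S n u c}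
  let K : ℕ := ∑ u, φ u + B
  let χ : G.V → ℕ := fun u =>
    if h : ∃ c : ℕ, ∀ n, G.Survives S n u c then Nat.find h + K else 0
  let φ' : G.V → ℕ := fun u => if u ∈ S then φ u else χ u
  have hpot : G.IsPotential (S ∪ T) φ' := by
    rintro u (hu | ⟨hu, hc⟩)
    · refine (hφ u hu).mono fun e _ _ he => ⟨Or.inl he.1, ?_⟩
      simpa only [φ', if_pos hu, if_pos he.1] using he.2
    · have hu' : φ' u = Nat.find hc + K := by simp only [φ', χ, if_neg hu, dif_pos hc]
      refine (forces_of_forall_survives hu (Nat.find_spec hc)).mono fun e he _ hs => ?_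
      rw [hu']
      by_cases heS : e.2.2 ∈ S
      · refine ⟨Or.inl heS, ?_⟩
        have h1 : φ e.2.2 ≤ ∑ u, φ u :=
          Finset.single_le_sum (fun _ _ => Nat.zero_le _) (Finset.mem_univ _)
        have h2 := (abs_le.1 (hB e he)).1
        simp only [φ', if_pos heS, K, Nat.cast_add]
        omega
      · obtain ⟨d, hd⟩ := Int.eq_ofNat_of_zero_le ((hs 0).nonneg heS)
        rw [hd] at hs
        have hc' : ∃ c : ℕ, ∀ n, G.Survives S n e.2.2 c := ⟨d, hs⟩
        refine ⟨Or.inr ⟨heS, hc'⟩, ?_⟩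
        have h1 : Nat.find hc' ≤ d := Nat.find_min' hc' hs
        simp only [φ', χ, if_neg heS, dif_pos hc']
        push_cast
        omega
  exact hv (hS.le_of_ge ⟨φ', hpot⟩ Set.subset_union_left (Or.inr ⟨hv, 0, hcon⟩))

/-- If Eve does not force `Q`, then against any strategy Adam can make the next edge
violate `Q`. -/
theorem exists_edge_of_not_forces (σ : Strategy G) {p : List (G.V × ℤ × G.V)}
    (hp : FinPath G.E G.init p) {Q : G.V × ℤ × G.V → Prop}
    (h : ¬ G.Forces (lastV G.init p) Q) :
    ∃ e ∈ G.E, e.1 = lastV G.init p ∧ (lastV G.init p ∈ G.EveV → σ.f p = e) ∧ ¬ Q e := by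
  by_cases hv : lastV G.init p ∈ G.EveV
  · obtain ⟨h1, h2⟩ := σ.valid p hp hv
    exact ⟨σ.f p, h1, h2, fun _ => rfl,
      fun hQ => h ⟨fun _ => ⟨_, h1, h2, hQ⟩, fun h => absurd hv h⟩⟩
  · by_contra! hcon
    exact h ⟨fun h => absurd h hv, fun _ e he h1 => hcon e he h1 fun h => absurd h hv⟩

/-- If from every vertex outside `S` Eve runs out of the credit `0` within `N` steps,
then no strategy of Eve ensures mean payoff from outside `S`. -/
theorem not_ensuresMP_of_not_survives {N : ℕ} (hN : ∀ v ∉ S, ¬ G.Survives S N v 0)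
    (hinit : G.init ∉ S) (σ : Strategy G) : ¬ EnsuresMP σ := by
  obtain ⟨B, hB⟩ := G.exists_weight_bound
  let P : List (G.V × ℤ × G.V) → Prop := fun p => FinPath G.E G.init p ∧
    ∃ (c : ℤ) (k : ℕ), 0 ≤ c ∧ k ≤ N ∧ c ≤ (N - k) * B ∧
      (N : ℤ) * (pathWeight p - c) + p.length ≤ N - k ∧
      ¬ G.Survives S k (lastV G.init p) c
  let R : List (G.V × ℤ × G.V) → G.V × ℤ × G.V → Prop := fun p e =>
    e ∈ G.E ∧ e.1 = lastV G.init p ∧ (lastV G.init p ∈ G.EveV → σ.f p = e)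
  have h0 : P [] := by
    refine ⟨⟨by simp, List.isChain_nil, by simp⟩, 0, N, le_rfl, le_rfl, by simp,
      by simp [pathWeight], ?_⟩
    simpa [lastV] using hN _ hinit
  have hstep : ∀ p, P p → ∃ e, R p e ∧ P (p ++ [e]) := by
    rintro p ⟨hp, c, k, hc, hk, hcB, hw, hs⟩
    cases k with
    | zero => exact absurd (Or.inr hc) hs
    | succ k =>
      have hs' := (not_and.1 (not_or.1 hs).2) hc
      obtain ⟨e, he, hep, hσ, hse⟩ := exists_edge_of_not_forces σ hp hs'
      refine ⟨e, ⟨he, hep, hσ⟩, hp.append_singleton he hep, ?_⟩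
      have hpw : pathWeight (p ++ [e]) = pathWeight p + e.2.1 := by simp [pathWeight]
      have hlen : (p ++ [e]).length = p.length + 1 := by simp
      rw [hpw, hlen, lastV_append_singleton]
      push_cast at hw hcB ⊢
      rcases lt_or_ge (c + e.2.1) 0 with hneg | hpos
      · have hmem : e.2.2 ∉ S := by
          intro h
          cases k with
          | zero => exact hse (Or.inl h)
          | succ k => exact hse (Or.inl h)
        refine ⟨0, N, le_rfl, le_rfl, by simp, ?_, hN _ hmem⟩
        have : (N : ℤ) * (c + e.2.1) ≤ N * (-1) :=
          mul_le_mul_of_nonneg_left (by omega) (by positivity)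
        linarith
      · refine ⟨c + e.2.1, k, hpos, by omega, ?_, ?_, hse⟩
        · linarith [(abs_le.1 (hB e he)).2]
        · linarith
  obtain ⟨π, hπ⟩ := exists_seq_of_forall_extend h0 hstep
  have hstart : (π 0).1 = G.init := (hπ 0).2.2.1
  have hchain : ∀ i, (π i).2.2 = (π (i + 1)).1 := by
    intro i
    have := (hπ (i + 1)).2.2.1
    rw [List.range_succ, List.map_append, List.map_singleton, lastV_append_singleton] at this
    exact this.symm
  intro hσ
  refine not_meanPayoffSeq_of_sum_le (B := B) (N := N) (D := N + N * (N * B))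
    (fun i => hB _ (hπ i).2.1) (fun n => ?_)
    (hσ π ⟨⟨fun i => (hπ i).2.1, hchain⟩, hstart, fun i hi => ?_⟩)
  · obtain ⟨-, c, k, hc, hk, hcB, hw, -⟩ := (hπ n).1
    rw [pathWeight_map_range, List.length_map, List.length_range] at hw
    have hcN : c ≤ N * B :=
      hcB.trans (mul_le_mul_of_nonneg_right (by omega) (by positivity))
    have := mul_le_mul_of_nonneg_left hcN (Int.natCast_nonneg N)
    push_cast
    linarith [Int.natCast_nonneg k]
  · exact (hπ i).2.2.2 (by rwa [lastV_map_range hstart hchain])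

end MPGame

/-- positional determinacy for mean payoff games:
for every mean payoff game, if Eve has a strategy ensuring mean payoff,
then she has a positional strategy ensuring mean payoff. -/
theorem positional_determinacy {W : Finset ℤ} (G : MPGame W)
    (h : ∃ σ : Strategy G, EnsuresMP σ) :
    ∃ σ : PosStrategy G, EnsuresMP σ.induced := by
  obtain ⟨τ, hτ⟩ := h
  obtain ⟨S, hS⟩ := (Set.toFinite {S : Set G.V | ∃ φ, G.IsPotential S φ}).exists_maximal
    ⟨∅, 0, fun _ h => h.elim⟩
  obtain ⟨φ, hφ⟩ := hS.prop
  by_cases hinit : G.init ∈ S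
  · exact G.exists_posStrategy_of_isPotential hφ hinit
  · have hex : ∀ v, ∃ n, v ∉ S → ¬ G.Survives S n v 0 := fun v => by
      by_cases hv : v ∈ S
      · exact ⟨0, fun h => absurd hv h⟩
      · exact (MPGame.exists_not_survives hS hv).imp fun _ h _ => h
    choose m hm using hex
    refine absurd hτ (MPGame.not_ensuresMP_of_not_survives
      (N := Finset.univ.sup m) (fun v hv hs => hm v hv (hs.anti ?_)) hinit τ)
    exact Finset.le_sup (Finset.mem_univ v)
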